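/- Let ℙ be a finitely characterized, stationary, ergodic process over a finite alphabet 𝒳 with positive-probability predictive equivalence classes E_1,…,E_N. Then for every predictive equivalence class E_β (not necessarily of positive probability), ℙ^-(E_β) = Σ_{i=1}^N Σ_{x∈𝒳} ℙ^-(E_i) · 𝐏(x|E_i) · I(x,i,β), where I(x,i,β) = 1 if 𝐏(x|E_i) > 0 and δ_h(E_i, x) = E_β, and I(x,i,β) = 0 otherwise. -/

import Mathlib

open MeasureTheory Filter Topology
open scoped Classical

namespace EM

variable {X : Type*} [Fintype X] [MeasurableSpace X] [MeasurableSingletonClass X]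

/-- The left shift on bi-infinite sequences. -/
def shift (ω : ℤ → X) : ℤ → X := fun n => ω (n + 1)

/-- ℙ(w): probability of the cylinder set of the word `w` at position 0. -/
noncomputable def wordProb (μ : Measure (ℤ → X)) (w : List X) : ℝ :=
  (μ {ω | ∀ k : Fin w.length, ω ((k : ℕ) : ℤ) = w.get k}).toReal

/-- Stationarity: invariance of the measure under the shift. -/
def Stationary (μ : Measure (ℤ → X)) : Prop := Measure.map shift μ = μ

/-- Ergodicity: every shift-invariant measurable event is trivial. -/
def Ergodic' (μ : Measure (ℤ → X)) : Prop :=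
  ∀ A : Set (ℤ → X), MeasurableSet A → shift ⁻¹' A = A → μ A = 0 ∨ μ A = 1

/-- Projection of a bi-infinite sequence to its past:  (pastMap ω) n = x_{-(n+1)}. -/
def pastMap (ω : ℤ → X) : ℕ → X := fun n => ω (-((n : ℤ) + 1))

/-- ℙ⁻ : the marginal of ℙ on past sequences. -/
noncomputable def pastMeasure (μ : Measure (ℤ → X)) : Measure (ℕ → X) :=
  Measure.map pastMap μ

/-- x⃖^t = x_{-t} … x_{-1}, the last `t` symbols of the past `p`, as a word. -/
def pastWord (p : ℕ → X) (t : ℕ) : List X := (List.range t).reverse.map p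

/-- A past is nontrivial if all of its finite suffixes have positive probability. -/
def Nontrivial' (μ : Measure (ℤ → X)) (p : ℕ → X) : Prop :=
  ∀ t : ℕ, 0 < wordProb μ (pastWord p t)

/-- ℙ(w | v) = ℙ(vw)/ℙ(v): conditional probability that `w` follows `v`. -/
noncomputable def condProb (μ : Measure (ℤ → X)) (w v : List X) : ℝ :=
  wordProb μ (v ++ w) / wordProb μ v

/-- A past is `w`-regular if it is nontrivial and lim_{t→∞} ℙ(w|x⃖^t) exists. -/
def WRegular (μ : Measure (ℤ → X)) (p : ℕ → X) (w : List X) : Prop :=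
  Nontrivial' μ p ∧ ∃ L : ℝ, Tendsto (fun t => condProb μ w (pastWord p t)) atTop (𝓝 L)

/-- A past is regular if it is nontrivial and `w`-regular for every nonempty word `w`. -/
def Regular (μ : Measure (ℤ → X)) (p : ℕ → X) : Prop :=
  Nontrivial' μ p ∧ ∀ w : List X, w ≠ [] →
    ∃ L : ℝ, Tendsto (fun t => condProb μ w (pastWord p t)) atTop (𝓝 L)

/-- 𝐏(w|x⃖) = lim_{t→∞} ℙ(w|x⃖^t)  (meaningful for regular pasts). -/
noncomputable def predProb (μ : Measure (ℤ → X)) (p : ℕ → X) (w : List X) : ℝ :=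
  limUnder atTop (fun t => condProb μ w (pastWord p t))

/-- The past x⃖x obtained by appending the symbol `x` to the past x⃖. -/
def extendPast (p : ℕ → X) (x : X) : ℕ → X
  | 0 => x
  | n + 1 => p n

/-- The past obtained by appending a word symbol by symbol. -/
def extendWord (p : ℕ → X) : List X → (ℕ → X)
  | [] => p
  | x :: u => extendWord (extendPast p x) u

/-- The predictive equivalence class of the (regular) past `p`. -/
def classOf (μ : Measure (ℤ → X)) (p : ℕ → X) : Set (ℕ → X) :=
  {q | Regular μ q ∧ ∀ w : List X, w ≠ [] → predProb μ q w = predProb μ p w}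

section HMM

variable {S : Type*} [Fintype S] [DecidableEq S]

/-- T^(w) = T^(w₀) ⋯ T^(w_{l-1}). -/
def wordMatrix (T : X → Matrix S S ℝ) (w : List X) : Matrix S S ℝ :=
  (w.map T).prod

/-- 𝐏_{σ_i}(w) = ‖e_i T^(w)‖₁, the probability of emitting `w` from state `i`. -/
noncomputable def stateWordProb (T : X → Matrix S S ℝ) (i : S) (w : List X) : ℝ :=
  ∑ j, wordMatrix T w i j

/-- All transition matrices have nonnegative entries. -/
def HMMNonneg (T : X → Matrix S S ℝ) : Prop := ∀ x i j, 0 ≤ T x i j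

/-- The overall transition matrix T = Σ_x T^(x) is row-stochastic. -/
def HMMStochastic (T : X → Matrix S S ℝ) : Prop := ∀ i, ∑ x : X, ∑ j, T x i j = 1

/-- The overall state-to-state transition matrix T = Σ_x T^(x). -/
noncomputable def totalT (T : X → Matrix S S ℝ) : Matrix S S ℝ := ∑ x : X, T x

/-- Irreducibility: the directed graph with an edge i → j whenever T_{ij} > 0 is
strongly connected. -/
def Irreducible' (T : X → Matrix S S ℝ) : Prop :=
  ∀ i j : S, ∃ n : ℕ, 0 < n ∧ 0 < (totalT T ^ n) i j

/-- Unifilarity: from each state, each symbol leads to at most one state. -/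
def Unifilar (T : X → Matrix S S ℝ) : Prop :=
  ∀ (x : X) (i j k : S), 0 < T x i j → 0 < T x i k → j = k

/-- Probabilistically distinct states. -/
def ProbDistinct (T : X → Matrix S S ℝ) : Prop :=
  ∀ i j : S, i ≠ j → ∃ w : List X, w ≠ [] ∧ stateWordProb T i w ≠ stateWordProb T j w

/-- π is a stationary distribution for the HMM: π ≥ 0, Σπ = 1, π = πT. -/
def IsStationaryDist (T : X → Matrix S S ℝ) (π : S → ℝ) : Prop :=
  (∀ i, 0 ≤ π i) ∧ (∑ i, π i = 1) ∧ (∀ j, ∑ i, π i * totalT T i j = π j)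

/-- A generator ε-machine: a valid, irreducible, unifilar HMM with
probabilistically distinct states. -/
def IsGenEM (T : X → Matrix S S ℝ) : Prop :=
  HMMNonneg T ∧ HMMStochastic T ∧ Irreducible' T ∧ Unifilar T ∧ ProbDistinct T

/-- The set of regular pasts whose predictions agree with state `i` of the HMM `T`. -/
def stateClass (μ : Measure (ℤ → X)) (T : X → Matrix S S ℝ) (i : S) : Set (ℕ → X) :=
  {q | Regular μ q ∧ ∀ w : List X, w ≠ [] → predProb μ q w = stateWordProb T i w}

end HMM

/-- The symbol-labeled transition matrices of the history ε-machine, given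
representatives `p i` of the positive-probability predictive equivalence classes:
T^(x)_{ij} = 𝐏(x|E_i) if 𝐏(x|E_i) > 0 and δ_h(E_i,x) = E_j, and 0 otherwise. -/
noncomputable def histT (μ : Measure (ℤ → X)) {N : ℕ} (p : Fin N → (ℕ → X)) (x : X) :
    Matrix (Fin N) (Fin N) ℝ := fun i j =>
  if 0 < predProb μ (p i) [x] ∧ classOf μ (extendPast (p i) x) = classOf μ (p j)
  then predProb μ (p i) [x] else 0

/-- ℙ is finitely characterized, with the pasts `p i` representing the finitely many
positive-probability predictive equivalence classes E_i = classOf μ (p i). -/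
def FinitelyCharacterized (μ : Measure (ℤ → X)) {N : ℕ} (p : Fin N → (ℕ → X)) : Prop :=
  (∀ i, Regular μ (p i)) ∧
  (∀ i j : Fin N, i ≠ j → classOf μ (p i) ≠ classOf μ (p j)) ∧
  (∀ i, 0 < pastMeasure μ (classOf μ (p i))) ∧
  (∑ i, pastMeasure μ (classOf μ (p i)) = 1)

end EM

namespace EM

section PastSpace

variable {X : Type*}

/-- The pasts sharing their last `t` symbols with `q`. -/
def pastCylinder (q : ℕ → X) (t : ℕ) : Set (ℕ → X) := {r | ∀ n < t, r n = q n}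

/-- The past obtained by deleting the most recent symbol. -/
def dropPast (r : ℕ → X) : ℕ → X := fun n => r (n + 1)

theorem pastCylinder_antitone (q : ℕ → X) : Antitone (pastCylinder q) :=
  fun _ _ hst _ hr n hn => hr n (hn.trans_le hst)

theorem extendPast_dropPast (r : ℕ → X) : extendPast (dropPast r) (r 0) = r := by
  funext n; cases n <;> rfl

theorem pastCylinder_extendPast (q : ℕ → X) (x : X) (t : ℕ) :
    pastCylinder (extendPast q x) (t + 1) = {r | r 0 = x} ∩ dropPast ⁻¹' pastCylinder q t := by
  ext r
  constructor
  · intro h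
    exact ⟨h 0 t.succ_pos, fun n hn => h (n + 1) (Nat.succ_lt_succ hn)⟩
  · rintro ⟨h0, h⟩ n hn
    cases n with
    | zero => exact h0
    | succ n => exact h n (Nat.lt_of_succ_lt_succ hn)

theorem pastWord_extendPast (q : ℕ → X) (x : X) (t : ℕ) :
    pastWord (extendPast q x) (t + 1) = pastWord q t ++ [x] := by
  simp [pastWord, List.range_succ_eq_map, extendPast, Function.comp_def]

variable [MeasurableSpace X]

theorem measurable_dropPast : Measurable (dropPast : (ℕ → X) → ℕ → X) :=
  measurable_pi_lambda _ fun n => measurable_pi_apply (n + 1)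

theorem measurable_pastMap : Measurable (pastMap : (ℤ → X) → ℕ → X) :=
  measurable_pi_lambda _ fun n => measurable_pi_apply (-((n : ℤ) + 1))

theorem measurable_shift : Measurable (shift : (ℤ → X) → ℤ → X) :=
  measurable_pi_lambda _ fun n => measurable_pi_apply (n + 1)

theorem measurableSet_pastCylinder [MeasurableSingletonClass X] (q : ℕ → X) (t : ℕ) :
    MeasurableSet (pastCylinder q t) := by
  have : pastCylinder q t = ⋂ n ∈ Set.Iio t, (fun r : ℕ → X => r n) ⁻¹' {q n} := by
    ext r; simp [pastCylinder]
  rw [this]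
  exact MeasurableSet.biInter (Set.to_countable _)
    fun n _ => measurable_pi_apply n (measurableSet_singleton _)

theorem map_initial_eq_withDensity [Finite X] [MeasurableSingletonClass X]
    {ν ρ : Measure (ℕ → X)} [IsFiniteMeasure ν] (hle : ρ ≤ ν) (t : ℕ) :
    ρ.map (fun r (i : Fin t) => r i) = (ν.map (fun r (i : Fin t) => r i)).withDensity
      (fun a => ρ.map (fun r (i : Fin t) => r i) {a} / ν.map (fun r (i : Fin t) => r i) {a}) := by
  have hpr : Measurable (fun (r : ℕ → X) (i : Fin t) => r i) :=
    measurable_pi_lambda _ fun i => measurable_pi_apply _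
  refine Measure.ext_of_singleton fun a => ?_
  rw [withDensity_apply _ (measurableSet_singleton a), lintegral_singleton,
    ENNReal.div_mul_cancel']
  · exact fun h => le_antisymm ((Measure.map_mono hle hpr {a}).trans h.le) bot_le
  · exact fun h => absurd h (measure_ne_top _ _)

theorem map_initial_singleton [Finite X] [MeasurableSingletonClass X]
    (ν : Measure (ℕ → X)) (t : ℕ) (q : ℕ → X) :
    ν.map (fun r (i : Fin t) => r i) {(fun i => q i : Fin t → X)} = ν (pastCylinder q t) := by
  rw [Measure.map_apply (measurable_pi_lambda _ fun i => measurable_pi_apply _)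
    (measurableSet_singleton _)]
  congr 1
  ext r
  simp [pastCylinder, funext_iff, Fin.forall_iff]

theorem measurable_cylinderRatio [Finite X] [MeasurableSingletonClass X]
    (ν ρ : Measure (ℕ → X)) (t : ℕ) :
    Measurable fun q => ρ (pastCylinder q t) / ν (pastCylinder q t) := by
  simp_rw [← map_initial_singleton]
  exact (measurable_of_finite fun a : Fin t → X =>
    ρ.map (fun r (i : Fin t) => r i) {a} / ν.map (fun r (i : Fin t) => r i) {a}).comp
      (measurable_pi_lambda _ fun i => measurable_pi_apply _)

theorem setLIntegral_cylinderRatio [Finite X] [MeasurableSingletonClass X]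
    {ν ρ : Measure (ℕ → X)} [IsFiniteMeasure ν] (hle : ρ ≤ ν) (t : ℕ) (S : Set (Fin t → X)) :
    ∫⁻ q in (fun r (i : Fin t) => r i) ⁻¹' S, ρ (pastCylinder q t) / ν (pastCylinder q t) ∂ν
      = ρ ((fun r (i : Fin t) => r i) ⁻¹' S) := by
  have hpr : Measurable (fun (r : ℕ → X) (i : Fin t) => r i) :=
    measurable_pi_lambda _ fun i => measurable_pi_apply _
  have hS : MeasurableSet S := S.toFinite.measurableSet
  rw [← Measure.map_apply hpr hS, map_initial_eq_withDensity hle, withDensity_apply _ hS,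
    setLIntegral_map hS (measurable_of_finite _) hpr]
  simp_rw [← map_initial_singleton]

/-- A measure dominated by `ν` has the limit of its cylinder ratios as density. -/
theorem eq_withDensity_of_tendsto_cylinderRatio [Finite X] [MeasurableSingletonClass X]
    {ν ρ : Measure (ℕ → X)} [IsFiniteMeasure ν] (hle : ρ ≤ ν) {f : (ℕ → X) → ENNReal}
    (hf : ∀ᵐ q ∂ν,
      Tendsto (fun t => ρ (pastCylinder q t) / ν (pastCylinder q t)) atTop (𝓝 (f q))) :
    ρ = ν.withDensity f := by
  have : IsFiniteMeasure ρ := isFiniteMeasure_of_le ν hle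
  have hproj : IsProjectiveLimit ρ fun I : Finset ℕ => ρ.map I.restrict := fun _ => rfl
  refine hproj.unique fun I => ?_
  have hI : Measurable (I.restrict : (ℕ → X) → I → X) := Finset.measurable_restrict I
  refine Measure.ext fun C hC => ?_
  rw [Measure.map_apply hI hC, Measure.map_apply hI hC, withDensity_apply _ (hI hC)]
  set B : Set (ℕ → X) := I.restrict ⁻¹' C with hB
  have hlim : Tendsto (fun t => ∫⁻ q in B, ρ (pastCylinder q t) / ν (pastCylinder q t) ∂ν)
      atTop (𝓝 (∫⁻ q in B, f q ∂ν)) := by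
    refine tendsto_lintegral_of_dominated_convergence (fun _ => 1)
      (fun t => measurable_cylinderRatio ν ρ t)
      (fun t => Eventually.of_forall fun q => ?_) ?_ (ae_restrict_of_ae hf)
    · exact ENNReal.div_le_of_le_mul (by simpa using hle _)
    · simp
  have hconst : ∀ᶠ t in atTop,
      ∫⁻ q in B, ρ (pastCylinder q t) / ν (pastCylinder q t) ∂ν = ρ B := by
    filter_upwards [eventually_gt_atTop (I.sup id)] with t ht
    have hBt : B = (fun r (i : Fin t) => r i) ⁻¹' ((fun r (i : Fin t) => r i) '' B) := by
      refine Set.Subset.antisymm (Set.subset_preimage_image _ _) ?_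
      rintro r ⟨r', hr', hrr⟩
      have : I.restrict r = I.restrict r' := by
        funext n
        have hn : (n : ℕ) < t := (Finset.le_sup (f := id) n.2).trans_lt ht
        exact (congrFun hrr ⟨n, hn⟩).symm
      rw [hB, Set.mem_preimage, this]
      exact hr'
    rw [hBt]
    exact setLIntegral_cylinderRatio hle t _
  exact tendsto_nhds_unique (hlim.congr' hconst) tendsto_const_nhds

end PastSpace

section Stationary

variable {X : Type*} [MeasurableSpace X] {μ : Measure (ℤ → X)}

theorem shift_iterate_apply {X : Type*} (t : ℕ) (ω : ℤ → X) (k : ℤ) :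
    (shift^[t] ω) k = ω (k + t) := by
  induction t generalizing ω with
  | zero => simp
  | succ t ih =>
    rw [Function.iterate_succ_apply, ih]
    simp [shift, add_assoc]

instance [IsProbabilityMeasure μ] : IsProbabilityMeasure (pastMeasure μ) :=
  Measure.isProbabilityMeasure_map measurable_pastMap.aemeasurable

theorem Stationary.wordProb_pastWord [MeasurableSingletonClass X] (hstat : Stationary μ)
    (q : ℕ → X) (t : ℕ) :
    wordProb μ (pastWord q t) = (pastMeasure μ (pastCylinder q t)).toReal := by
  have hp : MeasurePreserving shift μ μ := ⟨measurable_shift, hstat⟩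
  have hC := measurableSet_pastCylinder q t
  rw [pastMeasure, Measure.map_apply measurable_pastMap hC,
    ← (hp.iterate t).measure_preimage (measurable_pastMap hC).nullMeasurableSet, wordProb]
  congr 2
  ext ω
  simp only [Set.mem_ofPred_eq, Set.mem_preimage, pastCylinder, pastMap, shift_iterate_apply,
    Fin.forall_iff]
  have hlen : (pastWord q t).length = t := by simp [pastWord]
  have hget (k : ℕ) (hk : k < (pastWord q t).length) :
      (pastWord q t).get ⟨k, hk⟩ = q (t - 1 - k) := by
    simp [pastWord]
  simp only [hget, hlen]
  constructor
  · intro h n hn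
    have := h (t - 1 - n) (by omega)
    rw [show t - 1 - (t - 1 - n) = n by omega] at this
    rw [← this]
    congr 1
    omega
  · intro h k hk
    rw [← h (t - 1 - k) (by omega)]
    congr 1
    omega

theorem Stationary.map_dropPast (hstat : Stationary μ) :
    (pastMeasure μ).map dropPast = pastMeasure μ := by
  have hcomp : (dropPast ∘ pastMap) ∘ shift = (pastMap : (ℤ → X) → ℕ → X) := by
    funext ω n
    simp only [Function.comp_apply, dropPast, pastMap, shift]
    congr 1
  calc (pastMeasure μ).map dropPast = μ.map (dropPast ∘ pastMap) :=
        Measure.map_map measurable_dropPast measurable_pastMap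
    _ = (μ.map shift).map (dropPast ∘ pastMap) := by rw [hstat]
    _ = pastMeasure μ := by
        rw [Measure.map_map (measurable_dropPast.comp measurable_pastMap) measurable_shift, hcomp,
          pastMeasure]

/-- The law of the past before the most recent symbol, on the event that this symbol is `x`. -/
noncomputable def lastSymbolMeasure (μ : Measure (ℤ → X)) (x : X) : Measure (ℕ → X) :=
  ((pastMeasure μ).restrict {r | r 0 = x}).map dropPast

theorem measurableSet_lastSymbol [MeasurableSingletonClass X] (x : X) :
    MeasurableSet {r : ℕ → X | r 0 = x} :=
  (measurableSet_singleton x).preimage (measurable_pi_apply 0)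

theorem lastSymbolMeasure_apply (x : X) {A : Set (ℕ → X)} (hA : MeasurableSet A) :
    lastSymbolMeasure μ x A = pastMeasure μ ({r | r 0 = x} ∩ dropPast ⁻¹' A) := by
  rw [lastSymbolMeasure, Measure.map_apply measurable_dropPast hA,
    Measure.restrict_apply (measurable_dropPast hA), Set.inter_comm]

theorem Stationary.lastSymbolMeasure_le (hstat : Stationary μ) (x : X) :
    lastSymbolMeasure μ x ≤ pastMeasure μ := by
  conv_rhs => rw [← hstat.map_dropPast]
  exact Measure.map_mono Measure.restrict_le_self measurable_dropPast

theorem Stationary.condProb_singleton [MeasurableSingletonClass X]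
    [IsProbabilityMeasure μ] (hstat : Stationary μ) (q : ℕ → X) (x : X) (t : ℕ) :
    condProb μ [x] (pastWord q t) =
      (lastSymbolMeasure μ x (pastCylinder q t) / pastMeasure μ (pastCylinder q t)).toReal := by
  rw [condProb, ← pastWord_extendPast, hstat.wordProb_pastWord, hstat.wordProb_pastWord,
    ENNReal.toReal_div, pastCylinder_extendPast,
    lastSymbolMeasure_apply x (measurableSet_pastCylinder q t)]

end Stationary

section Predictive

variable {X : Type*} [MeasurableSpace X] {μ : Measure (ℤ → X)}

theorem Regular.tendsto {q : ℕ → X} (hq : Regular μ q) {w : List X} (hw : w ≠ []) :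
    Tendsto (fun t => condProb μ w (pastWord q t)) atTop (𝓝 (predProb μ q w)) :=
  tendsto_nhds_limUnder (hq.2 w hw)

theorem condProb_nonneg (w v : List X) : 0 ≤ condProb μ w v :=
  div_nonneg ENNReal.toReal_nonneg ENNReal.toReal_nonneg

theorem Regular.predProb_nonneg {q : ℕ → X} (hq : Regular μ q) {w : List X} (hw : w ≠ []) :
    0 ≤ predProb μ q w :=
  ge_of_tendsto' (hq.tendsto hw) fun _ => condProb_nonneg _ _

theorem mem_classOf_self {q : ℕ → X} (hq : Regular μ q) : q ∈ classOf μ q := ⟨hq, fun _ _ => rfl⟩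

theorem classOf_eq_of_mem {q r : ℕ → X} (h : r ∈ classOf μ q) : classOf μ r = classOf μ q := by
  ext s
  exact and_congr_right fun _ => forall₂_congr fun w hw => by rw [h.2 w hw]

theorem mem_classOf_iff {q r : ℕ → X} (hr : Regular μ r) :
    r ∈ classOf μ q ↔ classOf μ r = classOf μ q :=
  ⟨classOf_eq_of_mem, fun h => h ▸ mem_classOf_self hr⟩

theorem classOf_eq_setOf (q : ℕ → X) :
    classOf μ q = {r | Nontrivial' μ r ∧ ∀ w : List X, w ≠ [] →
      Tendsto (fun t => condProb μ w (pastWord r t)) atTop (𝓝 (predProb μ q w))} := by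
  ext r
  constructor
  · rintro ⟨hr, h⟩
    exact ⟨hr.1, fun w hw => h w hw ▸ hr.tendsto hw⟩
  · rintro ⟨hr, h⟩
    exact ⟨⟨hr, fun w hw => ⟨_, h w hw⟩⟩, fun w hw => (h w hw).limUnder_eq⟩

theorem measurable_comp_pastWord [Finite X] [MeasurableSingletonClass X] (g : List X → ℝ)
    (t : ℕ) : Measurable fun r : ℕ → X => g (pastWord r t) := by
  have : (fun r : ℕ → X => g (pastWord r t)) =
      (fun a : Fin t → X => g (List.ofFn a).reverse) ∘ fun r (i : Fin t) => r i := by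
    funext r
    simp only [Function.comp_apply, pastWord, List.map_reverse]
    congr 2
    apply List.ext_getElem <;> simp
  rw [this]
  exact (measurable_of_finite _).comp (measurable_pi_lambda _ fun i => measurable_pi_apply _)

theorem measurableSet_classOf [Finite X] [MeasurableSingletonClass X] (q : ℕ → X) :
    MeasurableSet (classOf μ q) := by
  rw [classOf_eq_setOf]
  simp only [Nontrivial', measurableSet_setOfPred]
  refine (Measurable.forall fun t => ?_).and
    (Measurable.forall fun w => Measurable.forall fun _ => ?_) <;> rw [← measurableSet_setOfPred]
  · exact measurableSet_lt measurable_const (measurable_comp_pastWord (wordProb μ) t)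
  · exact measurableSet_tendsto _ fun t => measurable_comp_pastWord (condProb μ w) t

theorem condProb_append_singleton (w v : List X) (x : X) (hv : wordProb μ v ≠ 0) :
    condProb μ w (v ++ [x]) = condProb μ (x :: w) v / condProb μ [x] v := by
  rw [condProb, condProb, condProb, div_div_div_cancel_right₀ hv]
  simp

theorem Regular.tendsto_extendPast {r : ℕ → X} (hr : Regular μ r) {x : X}
    (hx : 0 < predProb μ r [x]) (w : List X) :
    Tendsto (fun t => condProb μ w (pastWord (extendPast r x) t)) atTop
      (𝓝 (predProb μ r (x :: w) / predProb μ r [x])) := by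
  rw [← tendsto_add_atTop_iff_nat 1]
  refine ((hr.tendsto (List.cons_ne_nil x w)).div (hr.tendsto (List.cons_ne_nil x [])) hx.ne').congr
    fun t => ?_
  rw [pastWord_extendPast, condProb_append_singleton _ _ _ (hr.1 t).ne']
  rfl

theorem Regular.extendPast [MeasurableSingletonClass X] [IsProbabilityMeasure μ]
    (hstat : Stationary μ) {r : ℕ → X}
    (hr : Regular μ r) {x : X} (hx : 0 < predProb μ r [x]) : Regular μ (extendPast r x) := by
  refine ⟨fun t => ?_, fun w _ => ⟨_, hr.tendsto_extendPast hx w⟩⟩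
  obtain ⟨s, hs, hts⟩ := (((hr.tendsto (List.cons_ne_nil x [])).eventually (lt_mem_nhds hx)).and
    (eventually_ge_atTop t)).exists
  have hpos : 0 < wordProb μ (pastWord (EM.extendPast r x) (s + 1)) := by
    rw [pastWord_extendPast]
    exact (div_pos_iff_of_pos_right (hr.1 s)).1 hs
  refine hpos.trans_le ?_
  rw [hstat.wordProb_pastWord, hstat.wordProb_pastWord]
  exact ENNReal.toReal_mono (measure_ne_top _ _)
    (measure_mono (pastCylinder_antitone _ (by omega)))

theorem classOf_extendPast_of_mem [MeasurableSingletonClass X]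
    [IsProbabilityMeasure μ] (hstat : Stationary μ) {q r : ℕ → X} (hq : Regular μ q)
    (hr : r ∈ classOf μ q) {x : X} (hx : 0 < predProb μ q [x]) :
    extendPast r x ∈ classOf μ (extendPast q x) := by
  have hrx : 0 < predProb μ r [x] := by rwa [hr.2 _ (List.cons_ne_nil _ _)]
  refine ⟨hr.1.extendPast hstat hrx, fun w _ => ?_⟩
  rw [predProb, predProb, (hr.1.tendsto_extendPast hrx w).limUnder_eq,
    (hq.tendsto_extendPast hx w).limUnder_eq, hr.2 _ (List.cons_ne_nil _ _),
    hr.2 _ (List.cons_ne_nil _ _)]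

end Predictive

section Balance

variable {X : Type*} [Fintype X] [MeasurableSpace X] [MeasurableSingletonClass X]
  {N : ℕ} {μ : Measure (ℤ → X)} [IsProbabilityMeasure μ] {p : Fin N → (ℕ → X)}

theorem FinitelyCharacterized.pairwise_disjoint {X : Type*} [MeasurableSpace X]
    {μ : Measure (ℤ → X)} {p : Fin N → (ℕ → X)} (hfc : FinitelyCharacterized μ p) :
    Pairwise (Function.onFun Disjoint fun i => classOf μ (p i)) := by
  intro i j hij
  refine Set.disjoint_left.2 fun r hi hj => hfc.2.1 i j hij ?_
  rw [← classOf_eq_of_mem hi, classOf_eq_of_mem hj]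

theorem FinitelyCharacterized.ae_mem (hfc : FinitelyCharacterized μ p) :
    ∀ᵐ r ∂pastMeasure μ, r ∈ ⋃ i, classOf μ (p i) := by
  have hU : MeasurableSet (⋃ i, classOf μ (p i)) :=
    MeasurableSet.iUnion fun i => measurableSet_classOf _
  refine (prob_compl_eq_zero_iff hU).2 ?_
  rw [measure_iUnion hfc.pairwise_disjoint fun i => measurableSet_classOf _, tsum_fintype]
  exact hfc.2.2.2

theorem tendsto_cylinderRatio {X : Type*} [MeasurableSpace X] [MeasurableSingletonClass X]
    {μ : Measure (ℤ → X)} [IsProbabilityMeasure μ] (hstat : Stationary μ) {q r : ℕ → X}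
    (hr : r ∈ classOf μ q) (x : X) :
    Tendsto (fun t => lastSymbolMeasure μ x (pastCylinder r t) / pastMeasure μ (pastCylinder r t))
      atTop (𝓝 (ENNReal.ofReal (predProb μ q [x]))) := by
  have h := hr.1.tendsto (List.cons_ne_nil x [])
  rw [hr.2 _ (List.cons_ne_nil x [])] at h
  refine (ENNReal.tendsto_ofReal h).congr fun t => ?_
  rw [hstat.condProb_singleton, ENNReal.ofReal_toReal]
  exact ne_top_of_le_ne_top ENNReal.one_ne_top
    (ENNReal.div_le_of_le_mul (by simpa using hstat.lastSymbolMeasure_le x _))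

/-- Conditionally on the class `E_i`, the next symbol is `x` with probability `𝐏(x|E_i)`. -/
theorem FinitelyCharacterized.lastSymbolMeasure_classOf (hfc : FinitelyCharacterized μ p)
    (hstat : Stationary μ) (i : Fin N) (x : X) :
    lastSymbolMeasure μ x (classOf μ (p i)) =
      ENNReal.ofReal (predProb μ (p i) [x]) * pastMeasure μ (classOf μ (p i)) := by
  have hf : ∀ᵐ q ∂pastMeasure μ, Tendsto
      (fun t => lastSymbolMeasure μ x (pastCylinder q t) / pastMeasure μ (pastCylinder q t))
      atTop (𝓝 (ENNReal.ofReal (predProb μ q [x]))) := by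
    filter_upwards [hfc.ae_mem] with r hr
    obtain ⟨j, hj⟩ := Set.mem_iUnion.1 hr
    exact tendsto_cylinderRatio hstat (mem_classOf_self hj.1) x
  rw [eq_withDensity_of_tendsto_cylinderRatio (hstat.lastSymbolMeasure_le x) hf,
    withDensity_apply _ (measurableSet_classOf _),
    setLIntegral_congr_fun (g := fun _ => ENNReal.ofReal (predProb μ (p i) [x]))
      (measurableSet_classOf _) fun r hr => by
        simp only [hr.2 _ (List.cons_ne_nil x [])]]
  simp

theorem FinitelyCharacterized.pastMeasure_transition (hfc : FinitelyCharacterized μ p)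
    (hstat : Stationary μ) (q : ℕ → X) (i : Fin N) (x : X) :
    (pastMeasure μ (classOf μ q ∩ ({r | r 0 = x} ∩ dropPast ⁻¹' classOf μ (p i)))).toReal =
      (pastMeasure μ (classOf μ (p i))).toReal * predProb μ (p i) [x] *
        (if 0 < predProb μ (p i) [x] ∧ classOf μ (extendPast (p i) x) = classOf μ q
          then (1 : ℝ) else 0) := by
  have hmass := hfc.lastSymbolMeasure_classOf hstat i x
  rw [lastSymbolMeasure_apply x (measurableSet_classOf _)] at hmass
  rcases ((hfc.1 i).predProb_nonneg (List.cons_ne_nil x [])).eq_or_lt with h0 | hpos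
  · rw [← h0] at hmass ⊢
    rw [ENNReal.ofReal_zero, zero_mul] at hmass
    simp [measure_mono_null Set.inter_subset_right hmass]
  · have hmem : ∀ r ∈ {r : ℕ → X | r 0 = x} ∩ dropPast ⁻¹' classOf μ (p i),
        r ∈ classOf μ (extendPast (p i) x) := by
      rintro r ⟨rfl, hr⟩
      simpa only [extendPast_dropPast] using classOf_extendPast_of_mem hstat (hfc.1 i) hr hpos
    by_cases hβ : classOf μ (extendPast (p i) x) = classOf μ q
    · rw [if_pos ⟨hpos, hβ⟩, Set.inter_eq_right.2 fun r hr => hβ ▸ hmem r hr, hmass,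
        ENNReal.toReal_mul, ENNReal.toReal_ofReal hpos.le]
      ring
    · rw [if_neg fun h => hβ h.2, mul_zero]
      have hempty : classOf μ q ∩ ({r | r 0 = x} ∩ dropPast ⁻¹' classOf μ (p i)) = ∅ := by
        refine Set.eq_empty_of_forall_notMem fun r hr => hβ ?_
        rw [← classOf_eq_of_mem (hmem r hr.2), classOf_eq_of_mem hr.1]
      simp [hempty]

end Balance

/-- For a finitely characterized process and any predictive equivalence class
E_β (represented by the regular past q),
ℙ⁻(E_β) = Σ_{i=1}^N Σ_{x∈𝒳} ℙ⁻(E_i)·𝐏(x|E_i)·I(x,i,β). -/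
theorem class_measure_balance
    {X : Type*} [Fintype X] [MeasurableSpace X] [MeasurableSingletonClass X]
    {N : ℕ} (μ : Measure (ℤ → X)) [IsProbabilityMeasure μ]
    (hstat : Stationary μ) (herg : Ergodic' μ)
    (p : Fin N → (ℕ → X)) (hfc : FinitelyCharacterized μ p)
    (q : ℕ → X) (hq : Regular μ q) :
    (pastMeasure μ (classOf μ q)).toReal
      = ∑ i : Fin N, ∑ x : X,
          (pastMeasure μ (classOf μ (p i))).toReal * predProb μ (p i) [x] *
            (if 0 < predProb μ (p i) [x] ∧
                classOf μ (extendPast (p i) x) = classOf μ q then (1 : ℝ) else 0) := by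
  have hdisj : Pairwise (Function.onFun Disjoint fun ix : Fin N × X =>
      classOf μ q ∩ ({r | r 0 = ix.2} ∩ dropPast ⁻¹' classOf μ (p ix.1))) := by
    rintro ⟨i, x⟩ ⟨j, y⟩ hne
    refine Set.disjoint_left.2 fun r hr hr' => hne ?_
    refine Prod.ext (by_contra fun hij => ?_) (hr.2.1.symm.trans hr'.2.1)
    exact Set.disjoint_left.1 (hfc.pairwise_disjoint hij) hr.2.2 hr'.2.2
  have hcover : classOf μ q =ᵐ[pastMeasure μ] ⋃ ix : Fin N × X,
      classOf μ q ∩ ({r | r 0 = ix.2} ∩ dropPast ⁻¹' classOf μ (p ix.1)) := by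
    have hdrop : MeasurePreserving dropPast (pastMeasure μ) (pastMeasure μ) :=
      ⟨measurable_dropPast, hstat.map_dropPast⟩
    rw [eventuallyEq_set]
    filter_upwards [hdrop.quasiMeasurePreserving.ae hfc.ae_mem] with r hr
    obtain ⟨i, hi⟩ := Set.mem_iUnion.1 hr
    simp only [Set.mem_iUnion]
    exact ⟨fun h => ⟨(i, r 0), h, rfl, hi⟩, fun ⟨_, h⟩ => h.1⟩
  rw [measure_congr hcover, measure_iUnion hdisj fun ix => (measurableSet_classOf q).inter
    ((measurableSet_lastSymbol _).inter (measurable_dropPast (measurableSet_classOf _))),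
    tsum_fintype, ENNReal.toReal_sum fun _ _ => measure_ne_top _ _, Fintype.sum_prod_type]
  exact Finset.sum_congr rfl fun i _ => Finset.sum_congr rfl fun x _ =>
    hfc.pastMeasure_transition hstat q i x

end EM
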